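/- arXiv:2605.04151 — 5 statements merged into one kernel-verified Lean document; each statement's English description precedes it below -/
import Mathlib

section
/- Let R be the Laurent polynomial ring in two variables over F₂, and let M be a 2×2 matrix over R with entries a,b,c,d such that M ≠ 0 and det(M) = 0. Then the following are equivalent: (1) there exist invertible matrices P, Q ∈ GL₂(R) such that P·M·Q is the matrix [[1,0],[0,0]]; (2) the ideal of R generated by the four entries a,b,c,d is the whole ring R. -/
open Matrix

noncomputable section

set_option synthInstance.maxHeartbeats 1000000
set_option maxHeartbeats 1000000

/-- `R = F₂[x^{±1}, y^{±1}]`, the Laurent polynomial ring in two variables over the field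
with two elements, realized as the monoid algebra of the additive group `ℤ × ℤ` over `ZMod 2`. -/
abbrev LaurentF2 : Type := AddMonoidAlgebra (ZMod 2) (ℤ × ℤ)

/-- The antipode automorphism `bar`, induced by the group automorphism `(a,b) ↦ (-a,-b)`. -/
def barR : LaurentF2 ≃ₐ[ZMod 2] LaurentF2 :=
  AddMonoidAlgebra.domCongr (ZMod 2) (ZMod 2) (AddEquiv.neg (ℤ × ℤ))

/-- The automorphism `σ`, induced by the group automorphism `(a,b) ↦ (b,a)`. -/
def sigR : LaurentF2 ≃ₐ[ZMod 2] LaurentF2 :=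
  AddMonoidAlgebra.domCongr (ZMod 2) (ZMod 2) (AddEquiv.prodComm : ℤ × ℤ ≃+ ℤ × ℤ)

/-- The automorphism `ρ`, induced by the group automorphism `(a,b) ↦ (-b,-a)`. -/
def rhoR : LaurentF2 ≃ₐ[ZMod 2] LaurentF2 :=
  AddMonoidAlgebra.domCongr (ZMod 2) (ZMod 2)
    ((AddEquiv.prodComm : ℤ × ℤ ≃+ ℤ × ℤ).trans (AddEquiv.neg (ℤ × ℤ)))

/-- The monomial `x`, of exponent `(1, 0)`. -/
def xGen : LaurentF2 := AddMonoidAlgebra.single ((1 : ℤ), (0 : ℤ)) 1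

/-- The monomial `y`, of exponent `(0, 1)`. -/
def yGen : LaurentF2 := AddMonoidAlgebra.single ((0 : ℤ), (1 : ℤ)) 1

/-- In a domain whose elements are all primal, a quadruple with `a * d = b * c` is the outer
product of two pairs. -/
lemma exists_outer_product_of_mul_eq_mul {R : Type*} [CommRing R] [IsDomain R]
    [DecompositionMonoid R] {a b c d : R} (h : a * d = b * c) :
    ∃ u₁ u₂ v₁ v₂ : R, a = u₁ * v₁ ∧ b = u₁ * v₂ ∧ c = u₂ * v₁ ∧ d = u₂ * v₂ := by
  rcases eq_or_ne a 0 with rfl | ha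
  · rw [zero_mul, eq_comm, mul_eq_zero] at h
    rcases h with rfl | rfl
    · exact ⟨0, 1, c, d, by simp⟩
    · exact ⟨b, d, 0, 1, by simp⟩
  · obtain ⟨p, q, ⟨b', rfl⟩, ⟨c', rfl⟩, rfl⟩ := exists_dvd_and_dvd_of_dvd_mul ⟨d, h.symm⟩
    refine ⟨p, c', q, b', rfl, rfl, mul_comm _ _, mul_left_cancel₀ ha ?_⟩
    linear_combination h

/-- An outer product of two coprime pairs is equivalent to `!![1, 0; 0, 0]`. -/
lemma exists_gl_mul_mul_eq_of_isCoprime {R : Type*} [CommRing R] {u₁ u₂ v₁ v₂ : R}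
    (hu : IsCoprime u₁ u₂) (hv : IsCoprime v₁ v₂) :
    ∃ P Q : GL (Fin 2) R,
      (P : Matrix (Fin 2) (Fin 2) R) * !![u₁ * v₁, u₁ * v₂; u₂ * v₁, u₂ * v₂] *
        (Q : Matrix (Fin 2) (Fin 2) R) = !![1, 0; 0, 0] := by
  obtain ⟨s, t, hst⟩ := hu
  obtain ⟨s', t', hst'⟩ := hv
  have hP : (!![s, t; -u₂, u₁]).det = 1 := by
    rw [det_fin_two_of]; linear_combination hst
  have hQ : (!![s', -v₂; t', v₁]).det = 1 := by
    rw [det_fin_two_of]; linear_combination hst'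
  refine ⟨GeneralLinearGroup.mk'' _ (hP ▸ isUnit_one),
    GeneralLinearGroup.mk'' _ (hQ ▸ isUnit_one), ?_⟩
  change !![s, t; -u₂, u₁] * _ * !![s', -v₂; t', v₁] = _
  rw [mul_fin_two, mul_fin_two]
  congr! 3
  · linear_combination (s' * v₁ + t' * v₂) * hst + hst'
  · congr! 1
    ring
  · congr! 2
    · ring
    · ring

lemma isCoprime_of_one_mem_span {R : Type*} [CommRing R] {p q : R} {S : Set R}
    (h1 : 1 ∈ Ideal.span S) (hS : ∀ r ∈ S, p ∣ r ∨ q ∣ r) : IsCoprime p q := by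
  have hle : Ideal.span S ≤ Ideal.span {p, q} := Ideal.span_le.2 fun r hr ↦ by
    rcases hS r hr with h | h
    · exact Ideal.mem_of_dvd _ h (Ideal.subset_span (by simp))
    · exact Ideal.mem_of_dvd _ h (Ideal.subset_span (by simp))
  exact Ideal.mem_span_pair.1 (hle h1)

/-- The inclusion of exponent monoids underlying `F₂[x, y] → F₂[x^{±1}, y^{±1}]`. -/
def exponentHom : (Fin 2 →₀ ℕ) →+ ℤ × ℤ where
  toFun f := (f 0, f 1)
  map_zero' := rfl
  map_add' f g := by simp

lemma exponentHom_injective : Function.Injective exponentHom := fun f g h ↦ by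
  simp only [exponentHom, AddMonoidHom.coe_mk, ZeroHom.coe_mk, Prod.mk.injEq, Nat.cast_inj] at h
  ext i
  fin_cases i
  exacts [h.1, h.2]

/-- The inclusion `F₂[x, y] → F₂[x^{±1}, y^{±1}]`. -/
def polynomialInclusion : MvPolynomial (Fin 2) (ZMod 2) →+* LaurentF2 :=
  AddMonoidAlgebra.mapDomainRingHom (ZMod 2) exponentHom

lemma polynomialInclusion_injective : Function.Injective polynomialInclusion :=
  AddMonoidAlgebra.mapDomain_injective exponentHom_injective

lemma polynomialInclusion_monomial (e : Fin 2 →₀ ℕ) (c : ZMod 2) :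
    polynomialInclusion (MvPolynomial.monomial e c) =
      AddMonoidAlgebra.single (exponentHom e) c :=
  AddMonoidAlgebra.mapDomain_single

lemma isUnit_single_one (e : ℤ × ℤ) : IsUnit (AddMonoidAlgebra.single e 1 : LaurentF2) :=
  IsUnit.of_mul_eq_one (AddMonoidAlgebra.single (-e) 1) <| by
    rw [AddMonoidAlgebra.single_mul_single, add_neg_cancel, one_mul, AddMonoidAlgebra.one_def]

lemma exists_polynomialInclusion_eq_mul (r : LaurentF2) :
    ∃ m s, IsUnit (polynomialInclusion m) ∧
      r * polynomialInclusion m = polynomialInclusion s := by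
  induction r using AddMonoidAlgebra.induction_linear with
  | zero => exact ⟨1, 0, by simp, by simp⟩
  | add f g hf hg =>
    obtain ⟨m, s, hm, hs⟩ := hf
    obtain ⟨n, t, hn, ht⟩ := hg
    refine ⟨m * n, s * n + t * m, by simpa using ⟨hm, hn⟩, ?_⟩
    simp only [map_mul, map_add, ← hs, ← ht]
    ring
  | single e c =>
    let toExp (i j : ℕ) : Fin 2 →₀ ℕ := Finsupp.equivFunOnFinite.symm ![i, j]
    refine ⟨MvPolynomial.monomial (toExp e.1.natAbs e.2.natAbs) 1,
      MvPolynomial.monomial (toExp (e.1 + e.1.natAbs).toNat (e.2 + e.2.natAbs).toNat) c, ?_, ?_⟩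
    · rw [polynomialInclusion_monomial]
      exact isUnit_single_one _
    · rw [polynomialInclusion_monomial, polynomialInclusion_monomial,
        AddMonoidAlgebra.single_mul_single, mul_one]
      congr 1
      ext <;> simp [exponentHom, toExp] <;> linarith [neg_abs_le e.1, neg_abs_le e.2]

instance : UniqueFactorizationMonoid LaurentF2 := by
  let : Algebra (MvPolynomial (Fin 2) (ZMod 2)) LaurentF2 := polynomialInclusion.toAlgebra
  have : IsLocalization ((IsUnit.submonoid LaurentF2).comap polynomialInclusion) LaurentF2 :=
    { map_units := fun m ↦ m.2
      surj := fun r ↦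
        have ⟨m, s, hm, hs⟩ := exists_polynomialInclusion_eq_mul r
        ⟨(s, ⟨m, hm⟩), hs⟩
      exists_of_eq := fun h ↦ ⟨1, by rw [polynomialInclusion_injective h]⟩ }
  exact .of_isLocalization ((IsUnit.submonoid LaurentF2).comap polynomialInclusion) LaurentF2


/-- Unimodular-entry reduction criterion: a nonzero singular 2×2 matrix over
`F₂[x^{±1},y^{±1}]` can be brought to the canonical form `[[1,0],[0,0]]` by invertible
matrices if and only if its entries generate the unit ideal. -/
theorem unimodular_entry_reduction_criterion
    (M : Matrix (Fin 2) (Fin 2) LaurentF2) (hM : M ≠ 0) (hdet : M.det = 0) :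
    (∃ (P : GL (Fin 2) LaurentF2) (Q : GL (Fin 2) LaurentF2),
        (P : Matrix (Fin 2) (Fin 2) LaurentF2) * M * (Q : Matrix (Fin 2) (Fin 2) LaurentF2) =
          !![1, 0; 0, 0]) ↔
      Ideal.span ({M 0 0, M 0 1, M 1 0, M 1 1} : Set LaurentF2) = ⊤ := by

  constructor
  · rintro ⟨P, Q, h⟩
    have h00 := congrFun (congrFun h 0) 0
    simp only [mul_apply, Fin.sum_univ_two, of_apply, cons_val_zero] at h00
    rw [Ideal.eq_top_iff_one, ← h00]
    have key (x) (hx : x ∈ ({M 0 0, M 0 1, M 1 0, M 1 1} : Set LaurentF2)) (p q : LaurentF2) :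
        p * x * q ∈ Ideal.span ({M 0 0, M 0 1, M 1 0, M 1 1} : Set LaurentF2) :=
      Ideal.mul_mem_right _ _ (Ideal.mul_mem_left _ _ (Ideal.subset_span hx))
    simp only [add_mul]
    exact add_mem (add_mem (key _ (by simp) _ _) (key _ (by simp) _ _))
      (add_mem (key _ (by simp) _ _) (key _ (by simp) _ _))
  · intro h
    have : IsDomain LaurentF2 := NoZeroDivisors.to_isDomain _
    rw [det_fin_two, sub_eq_zero] at hdet
    obtain ⟨u₁, u₂, v₁, v₂, ha, hb, hc, hd⟩ := exists_outer_product_of_mul_eq_mul hdet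
    rw [Ideal.eq_top_iff_one, ha, hb, hc, hd] at h
    rw [eta_fin_two M, ha, hb, hc, hd]
    exact exists_gl_mul_mul_eq_of_isCoprime (isCoprime_of_one_mem_span h (by simp))
      (isCoprime_of_one_mem_span h (by simp))
end
end

section
/- Let R be the Laurent polynomial ring in two variables over F₂, and let M be a 2×2 matrix over R with M ≠ 0 and det(M) = 0. Suppose the ideal generated by the entries of M is the whole ring R. Then for all positive integers n, m, writing π : R → R_{n,m} := R/(x^n − 1, y^m − 1) for the quotient map and M^{(n,m)} for the entrywise image of M: the kernel {v ∈ (R_{n,m})² : M^{(n,m)} v = 0} equals the R_{n,m}-submodule of (R_{n,m})² generated by the componentwise images under π of the vectors u ∈ R² with M u = 0; and likewise the left kernel {v ∈ (R_{n,m})² : vᵀ M^{(n,m)} = 0} equals the R_{n,m}-submodule generated by the images of the vectors u ∈ R² with uᵀ M = 0. -/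
open Matrix

noncomputable section

set_option synthInstance.maxHeartbeats 1000000
set_option maxHeartbeats 1000000

/-- The ideal `(x^n - 1, y^m - 1)` encoding periodic boundary conditions on an `n × m` torus. -/
def torusIdeal (n m : ℕ) : Ideal LaurentF2 := Ideal.span {xGen ^ n - 1, yGen ^ m - 1}

/-- The quotient ring `R_{n,m} = R/(x^n - 1, y^m - 1)`. -/
abbrev RTorus (n m : ℕ) : Type := LaurentF2 ⧸ torusIdeal n m

/-- The quotient map `π : R → R_{n,m}`. -/
def torusQuot (n m : ℕ) : LaurentF2 →+* RTorus n m := Ideal.Quotient.mk _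

/-- If a square matrix `M` has a generalized inverse `N`, meaning `M * N * M = M`, then the kernel
of its image under a surjective ring homomorphism is spanned by the images of kernel vectors. -/
theorem ker_mulVecLin_map_eq_span_of_mul_mul_eq {ι R S : Type*} [Fintype ι]
    [CommRing R] [CommRing S] {f : R →+* S} (hf : Function.Surjective f)
    {M N : Matrix ι ι R} (hN : M * N * M = M) :
    LinearMap.ker (M.map f).mulVecLin =
      Submodule.span S {w : ι → S | ∃ u : ι → R, M.mulVec u = 0 ∧ w = fun i => f (u i)} := by
  apply le_antisymm
  · intro v hv
    rw [LinearMap.mem_ker, Matrix.mulVecLin_apply] at hv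
    choose g hg using hf
    have hlift : f ∘ (fun i => g (v i)) = v := funext fun i => hg (v i)
    refine Submodule.subset_span
      ⟨(fun i => g (v i)) - N.mulVec (M.mulVec fun i => g (v i)), ?_, ?_⟩
    · rw [Matrix.mulVec_sub, Matrix.mulVec_mulVec, Matrix.mulVec_mulVec, hN, sub_self]
    · have hMv : f ∘ (M.mulVec fun i => g (v i)) = 0 := by
        rw [← hv]
        funext i
        rw [Function.comp_apply, RingHom.map_mulVec, hlift]
      funext i
      rw [Pi.sub_apply, map_sub, hg, RingHom.map_mulVec, hMv, Matrix.mulVec_zero,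
        Pi.zero_apply, sub_zero]
  · rw [Submodule.span_le]
    rintro _ ⟨u, hu, rfl⟩
    rw [SetLike.mem_coe, LinearMap.mem_ker, Matrix.mulVecLin_apply]
    funext i
    have h := RingHom.map_mulVec f M u i
    rw [hu, Pi.zero_apply, map_zero] at h
    exact h.symm

/-- A singular `2 × 2` matrix whose entries generate the unit ideal has a generalized inverse. -/
theorem exists_mul_mul_eq_of_det_eq_zero_of_span_entries_eq_top {R : Type*} [CommRing R]
    {M : Matrix (Fin 2) (Fin 2) R} (hdet : M.det = 0)
    (hI : Ideal.span ({M 0 0, M 0 1, M 1 0, M 1 1} : Set R) = ⊤) :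
    ∃ N : Matrix (Fin 2) (Fin 2) R, M * N * M = M := by
  have hone : (1 : R) ∈ Ideal.span ({M 0 0, M 0 1, M 1 0, M 1 1} : Set R) := hI ▸ trivial
  simp only [Ideal.mem_span_insert, Ideal.mem_span_singleton'] at hone
  obtain ⟨p, _, ⟨q, _, ⟨r, _, ⟨s, rfl⟩, rfl⟩, rfl⟩, h⟩ := hone
  rw [Matrix.det_fin_two] at hdet
  refine ⟨!![p, r; q, s], ?_⟩
  ext i j
  fin_cases i <;> fin_cases j <;> simp [Matrix.mul_apply, Fin.sum_univ_two]
  · linear_combination -M 0 0 * h - s * hdet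
  · linear_combination -M 0 1 * h + r * hdet
  · linear_combination -M 1 0 * h + q * hdet
  · linear_combination -M 1 1 * h - p * hdet

/-- If the entries of the nonzero singular matrix `M` generate the unit ideal, then on every
finite torus the (right and left) kernels of the reduced matrix `M^{(n,m)}` are generated by
the reductions of infinite-plane kernel vectors: no additional nonlocal stabilizers appear. -/
theorem no_nonlocal_stabilizers_of_entry_ideal_top
    (M : Matrix (Fin 2) (Fin 2) LaurentF2) (hM : M ≠ 0) (hdet : M.det = 0)
    (hI : Ideal.span ({M 0 0, M 0 1, M 1 0, M 1 1} : Set LaurentF2) = ⊤)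
    (n m : ℕ) (hn : 0 < n) (hm : 0 < m) :
    LinearMap.ker ((M.map (torusQuot n m)).mulVecLin) =
      Submodule.span (RTorus n m)
        {w : Fin 2 → RTorus n m |
          ∃ u : Fin 2 → LaurentF2, M.mulVec u = 0 ∧ w = fun i => torusQuot n m (u i)} ∧
    LinearMap.ker ((M.map (torusQuot n m)).vecMulLinear) =
      Submodule.span (RTorus n m)
        {w : Fin 2 → RTorus n m |
          ∃ u : Fin 2 → LaurentF2, M.vecMul u = 0 ∧ w = fun i => torusQuot n m (u i)} := by
  have hf : Function.Surjective (torusQuot n m) := Ideal.Quotient.mk_surjective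
  obtain ⟨N, hN⟩ := exists_mul_mul_eq_of_det_eq_zero_of_span_entries_eq_top hdet hI
  refine ⟨ker_mulVecLin_map_eq_span_of_mul_mul_eq hf hN, ?_⟩
  have hNt : Mᵀ * Nᵀ * Mᵀ = Mᵀ := by
    rw [← Matrix.transpose_mul, ← Matrix.transpose_mul, ← Matrix.mul_assoc, hN]
  have h := ker_mulVecLin_map_eq_span_of_mul_mul_eq hf hNt
  rwa [Matrix.transpose_map, Matrix.mulVecLin_transpose,
    show Mᵀ.mulVec = fun u => M.vecMul u from funext (Matrix.mulVec_transpose M)] at h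
end
end

section
/- Let R be the Laurent polynomial ring in two variables over F₂, and let M be a 2×2 matrix over R with M ≠ 0 and det(M) = 0. Suppose the ideal I₁(M) generated by the entries of M is a proper ideal of R. Then there exist positive integers n, m such that, writing π : R → R_{n,m} := R/(x^n − 1, y^m − 1) for the quotient map and M^{(n,m)} for the entrywise image of M, the R_{n,m}-submodule of (R_{n,m})² generated by the componentwise images under π of the vectors u ∈ R² with M u = 0 is a proper submodule of the kernel {v ∈ (R_{n,m})² : M^{(n,m)} v = 0}. -/
open Matrix

noncomputable section

set_option synthInstance.maxHeartbeats 1000000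
set_option maxHeartbeats 1000000

/-- Two vectors killed by a nonzero `2 × 2` matrix over a domain are linearly dependent. -/
lemma cross_eq_zero_of_mulVec_eq_zero {A : Type*} [CommRing A] [IsDomain A]
    {M : Matrix (Fin 2) (Fin 2) A} (hM : M ≠ 0) {u v : Fin 2 → A}
    (hu : M.mulVec u = 0) (hv : M.mulVec v = 0) : u 0 * v 1 - u 1 * v 0 = 0 := by
  by_contra hD
  refine hM (Matrix.ext fun i j => ?_)
  have hui := congrFun hu i
  have hvi := congrFun hv i
  simp only [Matrix.mulVec, dotProduct, Fin.sum_univ_two, Pi.zero_apply] at hui hvi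
  refine (mul_eq_zero.mp ?_).resolve_right hD
  fin_cases j
  · simp only [Fin.zero_eta]
    linear_combination v 1 * hui - u 1 * hvi
  · simp only [Fin.mk_one]
    linear_combination u 0 * hvi - v 0 * hui

/-- If the vectors of a set in `A²` are pairwise dependent, so are those of its span. -/
lemma cross_eq_zero_of_mem_span {A : Type*} [CommRing A] {S : Set (Fin 2 → A)}
    (hS : ∀ u ∈ S, ∀ v ∈ S, u 0 * v 1 - u 1 * v 0 = 0) {u v : Fin 2 → A}
    (hu : u ∈ Submodule.span A S) (hv : v ∈ Submodule.span A S) :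
    u 0 * v 1 - u 1 * v 0 = 0 := by
  induction hu, hv using Submodule.span_induction₂ with
  | mem_mem u v hu hv => exact hS u hu v hv
  | zero_left v hv => simp
  | zero_right u hu => simp
  | add_left a b c _ _ _ h₁ h₂ =>
    simp only [Pi.add_apply]
    linear_combination h₁ + h₂
  | add_right a b c _ _ _ h₁ h₂ =>
    simp only [Pi.add_apply]
    linear_combination h₁ + h₂
  | smul_left r a b _ _ h =>
    simp only [Pi.smul_apply, smul_eq_mul]
    linear_combination r * h
  | smul_right r a b _ _ h =>
    simp only [Pi.smul_apply, smul_eq_mul]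
    linear_combination r * h

/-- Residue fields of `LaurentF2` at maximal ideals are finite. -/
lemma finite_quotient_of_isMaximal (P : Ideal LaurentF2) [P.IsMaximal] :
    Finite (LaurentF2 ⧸ P) := by
  let : Field (LaurentF2 ⧸ P) := Ideal.Quotient.field P
  have : Algebra.FiniteType (ZMod 2) (LaurentF2 ⧸ P) :=
    Algebra.FiniteType.of_surjective (Ideal.Quotient.mkₐ (ZMod 2) P)
      (Ideal.Quotient.mkₐ_surjective _ _)
  have : Module.Finite (ZMod 2) (LaurentF2 ⧸ P) :=
    finite_of_finite_type_of_isJacobsonRing (ZMod 2) (LaurentF2 ⧸ P)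
  exact Module.finite_of_finite (ZMod 2)

/-- Every monomial becomes an `n`-th root of unity on the `n × n` torus. -/
lemma torusQuot_single_pow (n : ℕ) (a : ℤ × ℤ) :
    torusQuot n n (AddMonoidAlgebra.single a 1) ^ n = 1 := by
  let H : AddSubgroup (ℤ × ℤ) :=
    { carrier := {a | torusQuot n n (AddMonoidAlgebra.single a 1) ^ n = 1}
      zero_mem' := by
        have h : (AddMonoidAlgebra.single 0 1 : LaurentF2) = 1 := rfl
        simp [h]
      add_mem' := fun {a b} ha hb => by
        have h : (AddMonoidAlgebra.single (a + b) 1 : LaurentF2) =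
            AddMonoidAlgebra.single a 1 * AddMonoidAlgebra.single b 1 := by
          simp [AddMonoidAlgebra.single_mul_single]
        simp only [Set.mem_ofPred_eq] at ha hb ⊢
        rw [h, map_mul, mul_pow, ha, hb, one_mul]
      neg_mem' := fun {a} ha => by
        have h : (AddMonoidAlgebra.single a 1 : LaurentF2) * AddMonoidAlgebra.single (-a) 1 = 1 := by
          rw [AddMonoidAlgebra.single_mul_single, add_neg_cancel, one_mul]; rfl
        simp only [Set.mem_ofPred_eq] at ha ⊢
        rw [← one_mul (_ ^ n), ← ha, ← mul_pow, ← map_mul, h, map_one, one_pow, ha] }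
  have hx : ((1, 0) : ℤ × ℤ) ∈ H := by
    have : torusQuot n n (xGen ^ n - 1) = 0 :=
      Ideal.Quotient.eq_zero_iff_mem.mpr (Ideal.subset_span (by simp))
    rw [map_sub, map_pow, map_one, sub_eq_zero] at this
    exact this
  have hy : ((0, 1) : ℤ × ℤ) ∈ H := by
    have : torusQuot n n (yGen ^ n - 1) = 0 :=
      Ideal.Quotient.eq_zero_iff_mem.mpr (Ideal.subset_span (by simp))
    rw [map_sub, map_pow, map_one, sub_eq_zero] at this
    exact this
  have ha : a = a.1 • ((1, 0) : ℤ × ℤ) + a.2 • ((0, 1) : ℤ × ℤ) := by ext <;> simp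
  have : a ∈ H := by
    rw [ha]
    exact H.add_mem (H.zsmul_mem hx _) (H.zsmul_mem hy _)
  exact this

/-- On the `(2 ^ k - 1) × (2 ^ k - 1)` torus the `k`-fold Frobenius is the identity. -/
lemma torusQuot_pow_two_pow {n k : ℕ} (hn : n + 1 = 2 ^ k) (f : LaurentF2) :
    torusQuot n n f ^ (n + 1) = torusQuot n n f := by
  have : CharP LaurentF2 2 :=
    charP_of_injective_algebraMap (algebraMap (ZMod 2) LaurentF2).injective 2
  have h : (torusQuot n n).comp (iterateFrobenius LaurentF2 2 k) = torusQuot n n := by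
    refine AddMonoidAlgebra.ringHom_ext (fun r => ?_) (fun a => ?_)
    · rw [RingHom.comp_apply, iterateFrobenius_def, AddMonoidAlgebra.single_pow, smul_zero,
        ZMod.pow_card_pow]
    · rw [RingHom.comp_apply, iterateFrobenius_def, map_pow, ← hn, pow_succ,
        torusQuot_single_pow, one_mul]
  have := RingHom.congr_fun h f
  rwa [RingHom.comp_apply, iterateFrobenius_def, map_pow, ← hn] at this

/-- At a maximal ideal `P` some torus has an element that annihilates finitely many given
elements of `P` while being a unit modulo `P`; in particular it is not nilpotent. -/
lemma exists_torus_annihilator (P : Ideal LaurentF2) [P.IsMaximal] {s : Finset LaurentF2}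
    (hs : ∀ f ∈ s, f ∈ P) :
    ∃ n : ℕ, 0 < n ∧ ∃ e : RTorus n n, e * e ≠ 0 ∧ ∀ f ∈ s, torusQuot n n f * e = 0 := by
  let : Field (LaurentF2 ⧸ P) := Ideal.Quotient.field P
  have := finite_quotient_of_isMaximal P
  let := Fintype.ofFinite (LaurentF2 ⧸ P)
  have : CharP (LaurentF2 ⧸ P) 2 :=
    charP_of_injective_algebraMap (algebraMap (ZMod 2) (LaurentF2 ⧸ P)).injective 2
  obtain ⟨k, -, hk⟩ := FiniteField.card (LaurentF2 ⧸ P) 2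
  have hcard : 1 < Fintype.card (LaurentF2 ⧸ P) := Fintype.one_lt_card
  obtain ⟨n, hn⟩ : ∃ n, n + 1 = Fintype.card (LaurentF2 ⧸ P) :=
    ⟨_, Nat.sub_add_cancel hcard.le⟩
  have hn0 : 0 < n := by omega
  have hroot : ∀ a b : ℤ × ℤ, a + b = 0 →
      (AddMonoidAlgebra.single a 1 : LaurentF2) ^ n - 1 ∈ P := fun a b hab => by
    have hne : Ideal.Quotient.mk P (AddMonoidAlgebra.single a 1) ≠ 0 := by
      refine left_ne_zero_of_mul_eq_one (b := Ideal.Quotient.mk P (AddMonoidAlgebra.single b 1)) ?_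
      rw [← map_mul, AddMonoidAlgebra.single_mul_single, hab, one_mul]
      exact map_one _
    rw [← Ideal.Quotient.eq_zero_iff_mem, map_sub, map_pow, map_one, sub_eq_zero]
    have := FiniteField.pow_card_sub_one_eq_one _ hne
    rwa [← hn, Nat.add_sub_cancel] at this
  have hle : torusIdeal n n ≤ P := by
    rw [torusIdeal, Ideal.span_le]
    rintro _ (rfl | rfl)
    · exact hroot (1, 0) (-1, 0) rfl
    · exact hroot (0, 1) (0, -1) rfl
  let ψ : RTorus n n →+* LaurentF2 ⧸ P := Ideal.Quotient.factor hle
  refine ⟨n, hn0, ∏ f ∈ s, (1 - torusQuot n n f ^ n), fun h => ?_, fun f hf => ?_⟩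
  · have hψ : ψ (∏ f ∈ s, (1 - torusQuot n n f ^ n)) = 1 := by
      rw [map_prod]
      refine Finset.prod_eq_one fun f hf => ?_
      have : ψ (torusQuot n n f) = 0 := Ideal.Quotient.eq_zero_iff_mem.mpr (hs f hf)
      rw [map_sub, map_pow, this, map_one, zero_pow hn0.ne', sub_zero]
    have := congrArg ψ h
    rw [map_mul, hψ, map_zero, one_mul] at this
    exact one_ne_zero this
  · rw [← Finset.mul_prod_erase s _ hf, ← mul_assoc, mul_sub, mul_one, ← pow_succ',
      torusQuot_pow_two_pow (hn.trans hk), sub_self, zero_mul]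

/-- If the entry ideal of the nonzero singular matrix `M` is proper, then on some finite torus
the kernel of the reduced matrix `M^{(n,m)}` is strictly larger than the submodule generated by
reductions of infinite-plane kernel vectors: additional nonlocal stabilizers appear. -/
theorem nonlocal_stabilizers_of_entry_ideal_proper
    (M : Matrix (Fin 2) (Fin 2) LaurentF2) (hM : M ≠ 0) (hdet : M.det = 0)
    (hI : Ideal.span ({M 0 0, M 0 1, M 1 0, M 1 1} : Set LaurentF2) ≠ ⊤) :
    ∃ n m : ℕ, 0 < n ∧ 0 < m ∧
      Submodule.span (RTorus n m)
          {w : Fin 2 → RTorus n m |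
            ∃ u : Fin 2 → LaurentF2, M.mulVec u = 0 ∧ w = fun i => torusQuot n m (u i)} <
        LinearMap.ker ((M.map (torusQuot n m)).mulVecLin) := by
  obtain ⟨P, hP, hle⟩ := Ideal.exists_le_maximal _ hI
  classical
  obtain ⟨n, hn, e, he, hann⟩ := exists_torus_annihilator P
    (s := {M 0 0, M 0 1, M 1 0, M 1 1}) fun f hf => hle (Ideal.subset_span (by simpa using hf))
  have hMe : ∀ i j, torusQuot n n (M i j) * e = 0 := fun i j =>
    hann _ (by fin_cases i <;> fin_cases j <;> simp)
  refine ⟨n, n, hn, hn, lt_of_le_of_ne (Submodule.span_le.mpr ?_) fun heq => he ?_⟩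
  · rintro _ ⟨u, hu, rfl⟩
    rw [SetLike.mem_coe, LinearMap.mem_ker, Matrix.mulVecLin_apply]
    ext i
    have := RingHom.map_mulVec (torusQuot n n) M u i
    rw [hu, Pi.zero_apply, map_zero] at this
    exact this.symm
  · have hker : ∀ j, Pi.single j e ∈ LinearMap.ker ((M.map (torusQuot n n)).mulVecLin) :=
      fun j => by
        rw [LinearMap.mem_ker, Matrix.mulVecLin_apply]
        ext i
        simp [hMe]
    have := cross_eq_zero_of_mem_span ?_ (heq ▸ hker 0) (heq ▸ hker 1)
    · simpa using this
    · rintro _ ⟨u, hu, rfl⟩ _ ⟨v, hv, rfl⟩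
      simp only [← map_mul, ← map_sub]
      rw [cross_eq_zero_of_mulVec_eq_zero hM hu hv, map_zero]
end
end

section
/- Let R be the Laurent polynomial ring in two variables over F₂, let M be a p×q matrix over R, and let r be its generic rank, i.e., I_r(M) ≠ 0 and I_{r+1}(M) = 0, where I_j(M) is the ideal generated by all j×j minors of M. Suppose I_r(M) = R. Then for all positive integers n, m, writing π : R → R_{n,m} := R/(x^n − 1, y^m − 1) for the quotient map and M^{(n,m)} for the entrywise image of M, the kernel {v ∈ (R_{n,m})^q : M^{(n,m)} v = 0} equals the R_{n,m}-submodule of (R_{n,m})^q generated by the componentwise images under π of the vectors u ∈ R^q with M u = 0. -/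
open Matrix

noncomputable section

set_option synthInstance.maxHeartbeats 1000000
set_option maxHeartbeats 1000000

/-- The determinantal ideal `I_j(M)`: the ideal generated by the determinants of all `j × j`
submatrices of `M` (chosen via injective row and column index maps); `I₀(M) = R`. -/
def detIdeal {p q : ℕ} (M : Matrix (Fin p) (Fin q) LaurentF2) (j : ℕ) : Ideal LaurentF2 :=
  Ideal.span {d : LaurentF2 | ∃ (r : Fin j → Fin p) (c : Fin j → Fin q),
    Function.Injective r ∧ Function.Injective c ∧ d = (M.submatrix r c).det}

namespace Matrix

variable {S : Type*} [CommRing S] {ι κ : Type*}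

/-- The adjugate form of the Schur complement formula for a bordered matrix, multiplied by the
determinant of the corner block. -/
theorem det_mul_det_fromBlocks_unit [Fintype ι] [DecidableEq ι] (A : Matrix ι ι S)
    (B : Matrix ι Unit S) (C : Matrix Unit ι S) (D : Matrix Unit Unit S) :
    A.det * (fromBlocks A B C D).det =
      A.det * (A.det * D () () - (C * (A.adjugate * B)) () ()) := by
  have hmul : fromBlocks A B C D * fromBlocks 1 (-(A.adjugate * B)) 0 (A.det • 1) =
      fromBlocks A 0 C (A.det • D - C * (A.adjugate * B)) := by
    rw [fromBlocks_multiply]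
    congr 1
    · simp
    · rw [Matrix.mul_neg, ← Matrix.mul_assoc, mul_adjugate]
      simp
    · simp
    · simp [sub_eq_add_neg, add_comm]
  have hdet := congrArg det hmul
  rw [det_mul, det_fromBlocks_zero₂₁, det_fromBlocks_zero₁₂] at hdet
  simp only [det_one, one_mul, det_unique, PUnit.default_eq_unit, smul_apply, one_apply_eq,
    smul_eq_mul, mul_one, sub_apply] at hdet
  rw [mul_comm, hdet]

/-- If all minors bordering the submatrix `A = M.submatrix ρ c` vanish, then
`det A • M = M_c * adj A * M_ρ`. -/
theorem det_submatrix_smul_eq_of_bordered_minors_eq_zero [IsDomain S] {r : ℕ}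
    (M : Matrix ι κ S) (ρ : Fin r → ι) (c : Fin r → κ) (hdet : (M.submatrix ρ c).det ≠ 0)
    (hM : ∀ (ρ' : Fin (r + 1) → ι) (c' : Fin (r + 1) → κ), (M.submatrix ρ' c').det = 0) :
    (M.submatrix ρ c).det • M =
      M.submatrix id c * ((M.submatrix ρ c).adjugate * M.submatrix ρ id) := by
  ext i k
  have hzero : (fromBlocks (M.submatrix ρ c) (M.submatrix ρ fun _ : Unit => k)
      (M.submatrix (fun _ : Unit => i) c) (M.submatrix (fun _ => i) fun _ => k)).det = 0 := by
    let e : Fin (r + 1) ≃ Fin r ⊕ Unit :=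
      finSumFinEquiv.symm.trans (Equiv.sumCongr (Equiv.refl _) (Equiv.ofUnique _ _))
    rw [← det_submatrix_equiv_self e, ← hM (Sum.elim ρ (fun _ => i) ∘ e)
      (Sum.elim c (fun _ => k) ∘ e), ← submatrix_submatrix]
    congr 2
    ext (a | a) (b | b) <;> rfl
  have hschur := det_mul_det_fromBlocks_unit (M.submatrix ρ c) (M.submatrix ρ fun _ : Unit => k)
    (M.submatrix (fun _ : Unit => i) c) (M.submatrix (fun _ => i) fun _ => k)
  rw [hzero, mul_zero, eq_comm, mul_eq_zero, or_iff_right hdet, sub_eq_zero] at hschur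
  simpa [mul_apply] using hschur

/-- A kernel vector of the reduction of `M`, multiplied by a maximal nonvanishing minor of `M`,
is the reduction of a kernel vector of `M`. -/
theorem exists_mulVec_eq_zero_of_map_mulVec_eq_zero [IsDomain S] {T : Type*} [CommRing T]
    [Fintype κ] [DecidableEq κ] {r : ℕ} (M : Matrix ι κ S) (ρ : Fin r → ι) (c : Fin r → κ)
    (hM : ∀ (ρ' : Fin (r + 1) → ι) (c' : Fin (r + 1) → κ), (M.submatrix ρ' c').det = 0)
    (f : S →+* T) (hf : Function.Surjective f) {v : κ → T} (hv : M.map f *ᵥ v = 0) :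
    ∃ u : κ → S, M *ᵥ u = 0 ∧ f (M.submatrix ρ c).det • v = fun i => f (u i) := by
  by_cases hdet : (M.submatrix ρ c).det = 0
  · exact ⟨0, by simp, by ext; simp [hdet]⟩
  have hsmul := det_submatrix_smul_eq_of_bordered_minors_eq_zero M ρ c hdet hM
  obtain ⟨w, rfl⟩ := hf.comp_left v
  have hw (i : ι) : f ((M *ᵥ w) i) = 0 := by
    rw [RingHom.map_mulVec]
    exact congrFun hv i
  set A := M.submatrix ρ c
  have hcol : M * (1 : Matrix κ κ S).submatrix id c = M.submatrix id c := by
    ext i k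
    simp [mul_apply, one_apply]
  refine ⟨A.det • w - (1 : Matrix κ κ S).submatrix id c *ᵥ (A.adjugate *ᵥ fun a => (M *ᵥ w) (ρ a)),
    ?_, ?_⟩
  · have hrow : (fun a => (M *ᵥ w) (ρ a)) = M.submatrix ρ id *ᵥ w := rfl
    rw [hrow, mulVec_sub, mulVec_smul, mulVec_mulVec, mulVec_mulVec, mulVec_mulVec, hcol,
      Matrix.mul_assoc, ← hsmul, smul_mulVec, sub_self]
  · ext i
    have hker : f ∘ (fun a => (M *ᵥ w) (ρ a)) = 0 := funext fun a => hw (ρ a)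
    have hadj : f ∘ (A.adjugate *ᵥ fun a => (M *ᵥ w) (ρ a)) = 0 := by
      ext a
      simp [RingHom.map_mulVec, hker]
    simp only [Pi.smul_apply, Pi.sub_apply, map_sub, smul_eq_mul, map_mul, Function.comp_apply,
      RingHom.map_mulVec _ (submatrix _ _ _), hadj, mulVec_zero, Pi.zero_apply, sub_zero]

/-- If the `r × r` minors of `M` generate the unit ideal and all larger minors vanish, then the
kernel of `M` commutes with reduction along a surjective ring homomorphism. -/
theorem ker_map_mulVecLin_eq_span [IsDomain S] {T : Type*} [CommRing T]
    [Fintype κ] [DecidableEq κ] {r : ℕ} (M : Matrix ι κ S)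
    (hM : ∀ (ρ : Fin (r + 1) → ι) (c : Fin (r + 1) → κ), (M.submatrix ρ c).det = 0)
    (htop : Ideal.span {d : S | ∃ (ρ : Fin r → ι) (c : Fin r → κ),
      Function.Injective ρ ∧ Function.Injective c ∧ d = (M.submatrix ρ c).det} = ⊤)
    (f : S →+* T) (hf : Function.Surjective f) :
    LinearMap.ker (M.map f).mulVecLin =
      Submodule.span T {w : κ → T | ∃ u : κ → S, M *ᵥ u = 0 ∧ w = fun i => f (u i)} := by
  apply le_antisymm
  · intro v hv
    rw [LinearMap.mem_ker, mulVecLin_apply] at hv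
    set N := Submodule.span T {w : κ → T | ∃ u : κ → S, M *ᵥ u = 0 ∧ w = fun i => f (u i)}
    have hle : ∀ d ∈ Ideal.span {d : S | ∃ (ρ : Fin r → ι) (c : Fin r → κ),
        Function.Injective ρ ∧ Function.Injective c ∧ d = (M.submatrix ρ c).det},
        f d • v ∈ N := by
      intro d hd
      induction hd using Submodule.span_induction with
      | mem d hd =>
        obtain ⟨ρ, c, -, -, rfl⟩ := hd
        obtain ⟨u, hu, huv⟩ := M.exists_mulVec_eq_zero_of_map_mulVec_eq_zero ρ c hM f hf hv
        exact Submodule.subset_span ⟨u, hu, huv⟩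
      | zero => simp
      | add a b _ _ ha hb => rw [map_add, add_smul]; exact N.add_mem ha hb
      | smul a b _ hb => rw [smul_eq_mul, map_mul, mul_smul]; exact N.smul_mem _ hb
    simpa using hle 1 (htop ▸ Submodule.mem_top)
  · rw [Submodule.span_le]
    rintro _ ⟨u, hu, rfl⟩
    rw [SetLike.mem_coe, LinearMap.mem_ker, mulVecLin_apply]
    ext i
    have hmap := RingHom.map_mulVec f M u i
    rw [hu, Pi.zero_apply, map_zero] at hmap
    exact hmap.symm

end Matrix

/-- The determinant of a submatrix chosen by arbitrary index maps lies in the determinantal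
ideal. -/
theorem det_submatrix_mem_detIdeal {p q j : ℕ} (M : Matrix (Fin p) (Fin q) LaurentF2)
    (ρ : Fin j → Fin p) (c : Fin j → Fin q) : (M.submatrix ρ c).det ∈ detIdeal M j := by
  by_cases hρ : Function.Injective ρ
  · by_cases hc : Function.Injective c
    · exact Ideal.subset_span ⟨ρ, c, hρ, hc, rfl⟩
    · obtain ⟨a, b, hab, hne⟩ := Function.not_injective_iff.mp hc
      rw [Matrix.det_zero_of_column_eq hne fun i => by simp [hab]]
      exact zero_mem _
  · obtain ⟨a, b, hab, hne⟩ := Function.not_injective_iff.mp hρ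
    rw [Matrix.det_zero_of_row_eq hne (by ext; simp [hab])]
    exact zero_mem _


/-- Determinantal-ideal criterion, unit-ideal case: if `M` has generic rank `r`
(`I_r(M) ≠ 0`, `I_{r+1}(M) = 0`) and `I_r(M) = R`, then on every finite torus the kernel of
the reduced matrix equals the submodule generated by reductions of infinite-plane kernel
vectors. -/
theorem kernel_eq_span_of_detIdeal_top
    (p q r : ℕ) (M : Matrix (Fin p) (Fin q) LaurentF2)
    (hr0 : detIdeal M r ≠ ⊥) (hr1 : detIdeal M (r + 1) = ⊥)
    (htop : detIdeal M r = ⊤)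
    (n m : ℕ) (hn : 0 < n) (hm : 0 < m) :
    LinearMap.ker ((M.map (torusQuot n m)).mulVecLin) =
      Submodule.span (RTorus n m)
        {w : Fin q → RTorus n m |
          ∃ u : Fin q → LaurentF2, M.mulVec u = 0 ∧ w = fun i => torusQuot n m (u i)} := by
  refine M.ker_map_mulVecLin_eq_span (fun ρ c => ?_) htop (torusQuot n m)
    Ideal.Quotient.mk_surjective
  simpa [hr1] using det_submatrix_mem_detIdeal M ρ c
end
end

section
/- Let R be the Laurent polynomial ring in two variables over F₂ with involutions bar, σ, ρ as below. For triples w = (f,g,h) and w' = (f',g',h') of elements of R, define μ(w,w') := bar(f)·σ(f') + bar(g)·σ(h') + bar(h)·σ(g'). Then for all triples w₁, w₂: ρ(μ(w₁,w₂)) = μ(w₂,w₁); in particular ρ(μ(w,w)) = μ(w,w) for every triple w. -/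
open Matrix

noncomputable section

set_option synthInstance.maxHeartbeats 1000000
set_option maxHeartbeats 1000000

/-- The reflected pairing `μ(w,w') = bar(f)·σ(f') + bar(g)·σ(h') + bar(h)·σ(g')` of triples. -/
def muPair (f g h f' g' h' : LaurentF2) : LaurentF2 :=
  barR f * sigR f' + barR g * sigR h' + barR h * sigR g'

theorem rhoR_barR (f : LaurentF2) : rhoR (barR f) = sigR f := by
  have h : (barR.trans rhoR : LaurentF2 ≃ₐ[ZMod 2] LaurentF2).toAlgHom = sigR.toAlgHom := by
    ext a
    all_goals simp [barR, rhoR, sigR]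
  exact DFunLike.congr_fun h f

theorem rhoR_sigR (f : LaurentF2) : rhoR (sigR f) = barR f := by
  have h : (sigR.trans rhoR : LaurentF2 ≃ₐ[ZMod 2] LaurentF2).toAlgHom = barR.toAlgHom := by
    ext a
    all_goals simp [barR, rhoR, sigR]
  exact DFunLike.congr_fun h f

theorem rhoR_muPair (f g h f' g' h' : LaurentF2) :
    rhoR (muPair f g h f' g' h') = muPair f' g' h' f g h := by
  simp only [muPair, map_add, map_mul, rhoR_barR, rhoR_sigR]
  ring

/-- `ρ(μ(w₁,w₂)) = μ(w₂,w₁)` for all triples; in particular `μ(w,w)` is `ρ`-fixed. -/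
theorem rho_muPair :
    (∀ f g h f' g' h' : LaurentF2,
        rhoR (muPair f g h f' g' h') = muPair f' g' h' f g h) ∧
    (∀ f g h : LaurentF2, rhoR (muPair f g h f g h) = muPair f g h f g h) :=
  ⟨rhoR_muPair, fun f g h => rhoR_muPair f g h f g h⟩
end
end
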